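/- Let h : X → Y be a coarsely Lipschitz map between metric spaces and let n ∈ ℕ₀. If for every r > 0 the collection 𝕐_r := {h⁻¹(B(y, r))}_{y∈Y} of preimages of open r-balls satisfies asdim(𝕐_r) ≤ n uniformly, then asdim X ≤ asdim Y + n. -/

import Mathlib

open Set Filter Pointwise

section Defs

variable {X Y G H : Type*}

/-- `d` is a metric on `X`. -/
def IsMetric (d : X → X → ℝ) : Prop :=
  (∀ x y, 0 ≤ d x y) ∧ (∀ x y, d x y = 0 ↔ x = y) ∧ (∀ x y, d x y = d y x) ∧
    (∀ x y z, d x z ≤ d x y + d y z)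

/-- `d` is a left-invariant metric on the group `G`. -/
def IsLeftInvariant [Group G] (d : G → G → ℝ) : Prop :=
  ∀ g x y : G, d (g * x) (g * y) = d x y

/-- `d` is proper: closed balls are compact, where a countable group is regarded as a
discrete topological space. -/
def IsProperMetric (d : G → G → ℝ) : Prop :=
  ∀ (x : G) (r : ℝ), @IsCompact G ⊥ {y | d x y ≤ r}

/-- The (left) defect set `D(f) = {f(y)⁻¹ f(x)⁻¹ f(xy) | x y ∈ G}` of a map between groups. -/
def defectSet [Group G] [Group H] (f : G → H) : Set H :=
  {h | ∃ x y : G, h = (f y)⁻¹ * (f x)⁻¹ * f (x * y)}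

/-- `f` is a quasimorphism if its defect set is finite. -/
def IsQuasimorphism [Group G] [Group H] (f : G → H) : Prop :=
  (defectSet f).Finite

/-- `f` is symmetric: `f(a⁻¹) = f(a)⁻¹`. -/
def IsSymmetricMap [Group G] [Group H] (f : G → H) : Prop :=
  ∀ a : G, f a⁻¹ = (f a)⁻¹

/-- `f` is unital: `f(e) = e`. -/
def IsUnitalMap [Group G] [Group H] (f : G → H) : Prop :=
  f 1 = 1

/-- `Λ` is an approximate subgroup of `G`: symmetric, unital and `Λ² ⊆ ΛF` for a finite `F`. -/
def IsApproxSubgroup [Group G] (Λ : Set G) : Prop :=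
  Λ⁻¹ = Λ ∧ (1 : G) ∈ Λ ∧ ∃ F : Set G, F.Finite ∧ Λ * Λ ⊆ Λ * F

/-- The subset `s` of `X` has asymptotic dimension at most `n`, with respect to the
(restriction of the) metric `d`: for every `R > 0` there is a cover of `s` by subsets of `s`,
uniformly bounded by some `D > 0`, splitting into `n + 1` `R`-disjoint families. -/
def ASDimLE (d : X → X → ℝ) (s : Set X) (n : ℕ) : Prop :=
  ∀ R : ℝ, 0 < R → ∃ D : ℝ, 0 < D ∧ ∃ 𝒰 : Fin (n + 1) → Set (Set X),
    (∀ i, ∀ u ∈ 𝒰 i, u ⊆ s) ∧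
    (s ⊆ ⋃ i, ⋃₀ 𝒰 i) ∧
    (∀ i, ∀ u ∈ 𝒰 i, ∀ x ∈ u, ∀ y ∈ u, d x y ≤ D) ∧
    (∀ i, ∀ u ∈ 𝒰 i, ∀ v ∈ 𝒰 i, u ≠ v → ∀ x ∈ u, ∀ y ∈ v, R ≤ d x y)

/-- The asymptotic dimension of the subset `s` of `X` with respect to the metric `d`,
as an element of `ℕ∞` (`⊤` means infinite asymptotic dimension). -/
noncomputable def asdim (d : X → X → ℝ) (s : Set X) : ℕ∞ :=
  sInf ((fun n : ℕ => (n : ℕ∞)) '' {n | ASDimLE d s n})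

/-- A family `𝒴` of subsets of `X` has asymptotic dimension uniformly bounded by `n`: for
every `R > 0` there is a common `D > 0` such that every member admits a `D`-bounded cover
splitting into `n + 1` `R`-disjoint families. -/
def ASDimUnifLE {ι : Type*} (d : X → X → ℝ) (𝒴 : ι → Set X) (n : ℕ) : Prop :=
  ∀ R : ℝ, 0 < R → ∃ D : ℝ, 0 < D ∧ ∀ α : ι, ∃ 𝒰 : Fin (n + 1) → Set (Set X),
    (∀ i, ∀ u ∈ 𝒰 i, u ⊆ 𝒴 α) ∧
    (𝒴 α ⊆ ⋃ i, ⋃₀ 𝒰 i) ∧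
    (∀ i, ∀ u ∈ 𝒰 i, ∀ x ∈ u, ∀ y ∈ u, d x y ≤ D) ∧
    (∀ i, ∀ u ∈ 𝒰 i, ∀ v ∈ 𝒰 i, u ≠ v → ∀ x ∈ u, ∀ y ∈ v, R ≤ d x y)

/-- `f` is coarsely Lipschitz on the subset `s`. -/
def IsCoarselyLipschitzOn (dX : X → X → ℝ) (dY : Y → Y → ℝ) (s : Set X) (f : X → Y) : Prop :=
  ∃ Φ : ℝ → ℝ, (∀ t, 0 ≤ t → 0 ≤ Φ t) ∧ MonotoneOn Φ (Ici (0 : ℝ)) ∧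
    Tendsto Φ atTop atTop ∧ ∀ x ∈ s, ∀ x' ∈ s, dY (f x) (f x') ≤ Φ (dX x x')

/-- `f` is coarsely Lipschitz: `d_Y(f x, f x') ≤ Φ₊(d_X(x, x'))` for a non-decreasing
`Φ₊ : [0,∞) → [0,∞)` tending to `∞`. -/
def IsCoarselyLipschitz (dX : X → X → ℝ) (dY : Y → Y → ℝ) (f : X → Y) : Prop :=
  ∃ Φ : ℝ → ℝ, (∀ t, 0 ≤ t → 0 ≤ Φ t) ∧ MonotoneOn Φ (Ici (0 : ℝ)) ∧
    Tendsto Φ atTop atTop ∧ ∀ x x' : X, dY (f x) (f x') ≤ Φ (dX x x')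

/-- `f` is a coarse equivalence from `(s, dX)` to `(t, dY)`: a coarse embedding whose image
is coarsely dense in `t`. -/
def IsCoarseEquivOn (dX : X → X → ℝ) (dY : Y → Y → ℝ) (s : Set X) (t : Set Y) (f : X → Y) :
    Prop :=
  MapsTo f s t ∧
  (∃ Φm Φp : ℝ → ℝ, (∀ u, 0 ≤ u → 0 ≤ Φm u) ∧ (∀ u, 0 ≤ u → 0 ≤ Φp u) ∧
    MonotoneOn Φm (Ici (0 : ℝ)) ∧ MonotoneOn Φp (Ici (0 : ℝ)) ∧
    Tendsto Φm atTop atTop ∧ Tendsto Φp atTop atTop ∧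
    ∀ x ∈ s, ∀ x' ∈ s,
      Φm (dX x x') ≤ dY (f x) (f x') ∧ dY (f x) (f x') ≤ Φp (dX x x')) ∧
  ∃ L : ℝ, 0 < L ∧ ∀ y ∈ t, ∃ x ∈ s, dY y (f x) < L

/-- `f : (X, dX) → (Y, dY)` is a coarse equivalence. -/
def IsCoarseEquiv (dX : X → X → ℝ) (dY : Y → Y → ℝ) (f : X → Y) : Prop :=
  IsCoarseEquivOn dX dY univ univ f

end Defs
section Helpers

variable {X Y Z : Type*}

def HwConn (d : X → X → ℝ) (A : Set X) (r : ℝ) : X → X → Prop :=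
  Relation.ReflTransGen (fun a b => a ∈ A ∧ b ∈ A ∧ d a b < r)

def HwBdd (d : X → X → ℝ) (A : Set X) (r D : ℝ) : Prop :=
  ∀ x y, HwConn d A r x y → d x y ≤ D

def HwFB (d : X → X → ℝ) (e : Z → Z → ℝ) (f : X → Z) (A : Set X) (r R D : ℝ) : Prop :=
  ∀ V : Set Z, (∀ z ∈ V, ∀ z' ∈ V, e z z' ≤ R) → HwBdd d (A ∩ f ⁻¹' V) r D

open Classical in
def HwKol (d : X → X → ℝ) (e : Z → Z → ℝ) (f : X → Z) (n k : ℕ) : Prop :=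
  ∀ r R : ℝ, 0 < r → 0 < R → ∃ D : ℝ, 0 < D ∧ ∃ C : Fin k → Set X,
    (∀ i, HwFB d e f (C i) r R D) ∧
    ∀ x, k ≤ (Finset.univ.filter (fun i => x ∈ C i)).card + n

theorem IsMetric.self {d : X → X → ℝ} (hd : IsMetric d) (x : X) : d x x = 0 :=
  (hd.2.1 x x).2 rfl

theorem IsMetric.sym {d : X → X → ℝ} (hd : IsMetric d) (x y : X) : d x y = d y x :=
  hd.2.2.1 x y

theorem IsMetric.tri {d : X → X → ℝ} (hd : IsMetric d) (x y z : X) : d x z ≤ d x y + d y z :=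
  hd.2.2.2 x y z

theorem HwConn.symm {d : X → X → ℝ} (hd : IsMetric d) {A : Set X} {r : ℝ} {x y : X}
    (h : HwConn d A r x y) : HwConn d A r y x := by
  induction h with
  | refl => exact Relation.ReflTransGen.refl
  | tail _ hbc ih =>
    exact Relation.ReflTransGen.head ⟨hbc.2.1, hbc.1, by rw [hd.sym]; exact hbc.2.2⟩ ih

theorem HwConn.mono {d : X → X → ℝ} {A A' : Set X} {r r' : ℝ} {x y : X}
    (h : HwConn d A r x y) (hA : A ⊆ A') (hr : r ≤ r') : HwConn d A' r' x y :=
  Relation.ReflTransGen.mono (fun _ _ h => ⟨hA h.1, hA h.2.1, h.2.2.trans_le hr⟩) _ _ h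

theorem HwConn.eq_or_mem {d : X → X → ℝ} {A : Set X} {r : ℝ} {x y : X}
    (h : HwConn d A r x y) : x = y ∨ x ∈ A := by
  rcases Relation.ReflTransGen.cases_head h with h | ⟨c, h, _⟩
  · exact Or.inl h
  · exact Or.inr h.1

theorem HwBdd.mono {d : X → X → ℝ} {A A' : Set X} {r r' D D' : ℝ}
    (h : HwBdd d A r D) (hA : A' ⊆ A) (hr : r' ≤ r) (hD : D ≤ D') : HwBdd d A' r' D' :=
  fun x y hxy => (h x y (hxy.mono hA hr)).trans hD

theorem HwBdd.local {d : X → X → ℝ} (hd : IsMetric d) {A : Set X} {r D : ℝ} (hD : 0 < D)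
    (h : ∀ x ∈ A, ∃ A', A ⊆ A' ∧ HwBdd d A' r D) : HwBdd d A r D := by
  intro x y hxy
  rcases hxy.eq_or_mem with rfl | hx
  · rw [hd.self]; exact hD.le
  · obtain ⟨A', hA, hB⟩ := h x hx
    exact hB x y (hxy.mono hA le_rfl)

theorem HwBdd.of_family {d : X → X → ℝ} (hd : IsMetric d) {𝒰 : Set (Set X)} {r D : ℝ}
    (hD : 0 < D) (h1 : ∀ u ∈ 𝒰, ∀ x ∈ u, ∀ y ∈ u, d x y ≤ D)
    (h2 : ∀ u ∈ 𝒰, ∀ v ∈ 𝒰, u ≠ v → ∀ x ∈ u, ∀ y ∈ v, r ≤ d x y) :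
    HwBdd d (⋃₀ 𝒰) r D := by
  intro x y hxy
  rcases hxy.eq_or_mem with rfl | ⟨u, hu, hx⟩
  · rw [hd.self]; exact hD.le
  · refine h1 u hu x hx y ?_
    induction hxy with
    | refl => exact hx
    | tail _ hbc ih =>
      obtain ⟨_, ⟨v, hv, hc⟩, hlt⟩ := hbc
      by_cases huv : u = v
      · rw [huv]; exact hc
      · exact absurd (h2 u hu v hv huv _ ih _ hc) (not_le.2 hlt)

theorem HwBdd.union {d : X → X → ℝ} (hd : IsMetric d) {A A' : Set X} {r D D' : ℝ}
    (hr : 0 < r) (hD : 0 < D) (hD' : 0 < D') (h : HwBdd d A r D)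
    (h' : HwBdd d A' (D + 2 * r) D') : HwBdd d (A ∪ A') r (D' + 2 * (D + r)) := by
  intro x y hxy
  have key : HwConn d A r x y ∨ ∃ a b, d x a ≤ D + r ∧ b ∈ A' ∧ HwConn d A' (D + 2 * r) a b ∧
      (y = b ∨ ∃ c, d b c < r ∧ HwConn d A r c y) := by
    induction hxy with
    | refl => exact Or.inl Relation.ReflTransGen.refl
    | @tail y z hxy hyz ih =>
      obtain ⟨hy, hz, hlt⟩ := hyz
      by_cases hzA : z ∈ A
      · rcases ih with h1 | ⟨a, b, hxa, hb, hab, rfl | ⟨c, hbc, hcy⟩⟩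
        · by_cases hyA : y ∈ A
          · exact Or.inl (Relation.ReflTransGen.tail h1 ⟨hyA, hzA, hlt⟩)
          · have hyA' : y ∈ A' := hy.resolve_left hyA
            have := h _ _ h1
            exact Or.inr ⟨y, y, by linarith, hyA', Relation.ReflTransGen.refl,
              Or.inr ⟨z, hlt, Relation.ReflTransGen.refl⟩⟩
        · exact Or.inr ⟨a, y, hxa, hb, hab, Or.inr ⟨z, hlt, Relation.ReflTransGen.refl⟩⟩
        · by_cases hyA : y ∈ A
          · exact Or.inr ⟨a, b, hxa, hb, hab,
              Or.inr ⟨c, hbc, Relation.ReflTransGen.tail hcy ⟨hyA, hzA, hlt⟩⟩⟩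
          · have hyA' : y ∈ A' := hy.resolve_left hyA
            have h1 := h _ _ hcy
            have h2 := hd.tri b c y
            exact Or.inr ⟨a, y, hxa, hyA',
              Relation.ReflTransGen.tail hab ⟨hb, hyA', by linarith⟩,
              Or.inr ⟨z, hlt, Relation.ReflTransGen.refl⟩⟩
      · have hzA' : z ∈ A' := hz.resolve_left hzA
        rcases ih with h1 | ⟨a, b, hxa, hb, hab, rfl | ⟨c, hbc, hcy⟩⟩
        · have h2 := h _ _ h1
          have h3 := hd.tri x y z
          exact Or.inr ⟨z, z, by linarith, hzA', Relation.ReflTransGen.refl, Or.inl rfl⟩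
        · exact Or.inr ⟨a, z, hxa, hzA',
            Relation.ReflTransGen.tail hab ⟨hb, hzA', by linarith⟩, Or.inl rfl⟩
        · have h1 := h _ _ hcy
          have h2 := hd.tri b c y
          have h3 := hd.tri b y z
          exact Or.inr ⟨a, z, hxa, hzA',
            Relation.ReflTransGen.tail hab ⟨hb, hzA', by linarith⟩, Or.inl rfl⟩
  rcases key with h1 | ⟨a, b, hxa, hb, hab, rfl | ⟨c, hbc, hcy⟩⟩
  · have := h _ _ h1
    linarith
  · have := h' _ _ hab
    have := hd.tri x a y
    linarith
  · have := h' _ _ hab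
    have := h _ _ hcy
    have := hd.tri x a y
    have := hd.tri a b y
    have := hd.tri b c y
    linarith

/-- Fibrewise decomposability of a subset. -/
def HwQ (d : X → X → ℝ) (e : Z → Z → ℝ) (f : X → Z) (n : ℕ) (R : ℝ) (A : Set X) : Prop :=
  ∀ r : ℝ, 0 < r → ∃ D : ℝ, 0 < D ∧ ∃ C : Fin (n + 1) → Set X,
    A ⊆ (⋃ j, C j) ∧ ∀ j, HwFB d e f (C j) r R D

theorem HwQ.union {d : X → X → ℝ} (hd : IsMetric d) {e : Z → Z → ℝ} {f : X → Z} {n : ℕ} {R : ℝ}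
    {A A' : Set X} (h : HwQ d e f n R A) (h' : HwQ d e f n R A') : HwQ d e f n R (A ∪ A') := by
  intro r hr
  obtain ⟨D, hD, C, hC, hF⟩ := h r hr
  obtain ⟨D', hD', C', hC', hF'⟩ := h' (D + 2 * r) (by linarith)
  refine ⟨D' + 2 * (D + r), by linarith, fun j => C j ∪ C' j, ?_, ?_⟩
  · rintro x (hx | hx)
    · obtain ⟨j, hj⟩ := mem_iUnion.1 (hC hx)
      exact mem_iUnion.2 ⟨j, Or.inl hj⟩
    · obtain ⟨j, hj⟩ := mem_iUnion.1 (hC' hx)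
      exact mem_iUnion.2 ⟨j, Or.inr hj⟩
  · intro j V hV
    rw [union_inter_distrib_right]
    exact HwBdd.union hd hr hD hD' (hF j V hV) (hF' j V hV)

theorem HwQ.empty {d : X → X → ℝ} (hd : IsMetric d) {e : Z → Z → ℝ} {f : X → Z} {n : ℕ} {R : ℝ} :
    HwQ d e f n R ∅ := by
  intro r hr
  refine ⟨1, one_pos, fun _ => ∅, empty_subset _, ?_⟩
  intro j V hV
  exact HwBdd.local hd one_pos (fun x hx => absurd hx.1 (notMem_empty x))

theorem HwQ.preimage {d : X → X → ℝ} (hd : IsMetric d) {e : Z → Z → ℝ} (he : IsMetric e)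
    {f : X → Z} {n : ℕ} {R L : ℝ} (hL : 0 < L)
    (hfib : ∀ r : ℝ, 0 < r → ASDimUnifLE d (fun y : Z => f ⁻¹' {z | e y z < r}) n)
    {B : Set Z} (hB : HwBdd e B (R + 1) L) : HwQ d e f n R (f ⁻¹' B) := by
  classical
  intro r hr
  obtain ⟨D, hD, H⟩ := hfib (L + 1) (by linarith) r hr
  choose U hU1 hU2 hU3 hU4 using H
  have hrep : ∃ rep : Z → Z, (∀ z, HwConn e B (R + 1) z (rep z)) ∧
      ∀ z z', HwConn e B (R + 1) z z' → rep z = rep z' := by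
    refine ⟨fun z => @Classical.epsilon Z ⟨z⟩ (fun w => HwConn e B (R + 1) z w), ?_, ?_⟩
    · intro z
      exact @Classical.epsilon_spec Z (fun w => HwConn e B (R + 1) z w)
        ⟨z, Relation.ReflTransGen.refl⟩
    · intro z z' h
      have : (fun w => HwConn e B (R + 1) z w) = (fun w => HwConn e B (R + 1) z' w) := by
        funext w
        exact propext ⟨fun hw => Relation.ReflTransGen.trans (h.symm he) hw,
          fun hw => Relation.ReflTransGen.trans h hw⟩
      show @Classical.epsilon Z ⟨z⟩ (fun w => HwConn e B (R + 1) z w) = _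
      rw [this]
  obtain ⟨rep, hrep1, hrep2⟩ := hrep
  refine ⟨D, hD, fun j => {x | f x ∈ B ∧ x ∈ ⋃₀ U (rep (f x)) j}, ?_, ?_⟩
  · intro x hx
    have h1 := hB _ _ ((hrep1 (f x)).symm he)
    have h2 : x ∈ f ⁻¹' {z | e (rep (f x)) z < L + 1} := by
      show e (rep (f x)) (f x) < L + 1
      linarith
    obtain ⟨j, hj⟩ := mem_iUnion.1 (hU2 _ h2)
    exact mem_iUnion.2 ⟨j, hx, hj⟩
  · intro j V hV
    refine HwBdd.local hd hD ?_
    rintro x ⟨⟨hxB, hxU⟩, hxV⟩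
    refine ⟨⋃₀ U (rep (f x)) j, ?_, HwBdd.of_family hd hD (hU3 _ j) (hU4 _ j)⟩
    rintro y ⟨⟨hyB, hyU⟩, hyV⟩
    have : rep (f x) = rep (f y) := by
      apply hrep2
      refine Relation.ReflTransGen.single ⟨hxB, hyB, ?_⟩
      have := hV _ hxV _ hyV
      linarith
    rw [this]; exact hyU

theorem HwKol.of_Q {d : X → X → ℝ} {e : Z → Z → ℝ} {f : X → Z} {n : ℕ}
    (h : ∀ R : ℝ, 0 < R → HwQ d e f n R univ) : HwKol d e f n (n + 1) := by
  classical
  intro r R hr hR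
  obtain ⟨D, hD, C, hC, hF⟩ := h R hR r hr
  refine ⟨D, hD, C, hF, ?_⟩
  intro x
  obtain ⟨j, hj⟩ := mem_iUnion.1 (hC (mem_univ x))
  have : 0 < (Finset.univ.filter (fun i => x ∈ C i)).card :=
    Finset.card_pos.2 ⟨j, by simpa using hj⟩
  have h2 : (Finset.univ.filter (fun i => x ∈ C i)).card + n ≥ n + 1 := by omega
  convert h2

theorem HwKol.succ {d : X → X → ℝ} (hd : IsMetric d) {e : Z → Z → ℝ} (he : IsMetric e)
    {f : X → Z} (hf : ∀ r : ℝ, 0 < r → ∃ S : ℝ, 0 < S ∧ ∀ x y, d x y < r → e (f x) (f y) ≤ S)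
    {n k : ℕ} (hk : n < k) (h : HwKol d e f n k) : HwKol d e f n (k + 1) := by
  classical
  intro r R hr hR
  obtain ⟨S, hS, hfS⟩ := hf r hr
  obtain ⟨D, hD, C, hF, hC⟩ := h (3 * r) (R + 2 * S) (by linarith) (by linarith)
  let C' : Fin k → Set X := fun i => {x | ∃ c ∈ C i, d x c < r}
  have hsub : ∀ i, C i ⊆ C' i := fun i x hx => ⟨x, hx, by rw [hd.self]; exact hr⟩
  let E : Set X := {x | (Finset.univ.filter (fun i => x ∈ C' i)).card + n ≤ k}
  refine ⟨D + 2 * r, by linarith, Fin.cons E C', ?_, ?_⟩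
  · intro i
    refine Fin.cases ?_ ?_ i
    · rw [Fin.cons_zero]
      intro V hV x y hxy
      rcases hxy.eq_or_mem with rfl | hx
      · rw [hd.self]; linarith
      have hEx : ∀ x ∈ E, Finset.univ.filter (fun i => x ∈ C i)
          = Finset.univ.filter (fun i => x ∈ C' i) := by
        intro x hx
        apply Finset.eq_of_subset_of_card_le
        · intro i hi
          simp only [Finset.mem_filter, Finset.mem_univ, true_and] at hi ⊢
          exact hsub i hi
        · have h1 : (Finset.univ.filter (fun i => x ∈ C' i)).card + n ≤ k := hx
          have h2 : k ≤ (Finset.univ.filter (fun i => x ∈ C i)).card + n := by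
            convert hC x
          omega
      have hstep : ∀ i, ∀ a ∈ E, ∀ b ∈ E, d a b < r → a ∈ C i → b ∈ C i := by
        intro i a ha b hb hab hi
        have h1 : i ∈ Finset.univ.filter (fun i => b ∈ C' i) := by
          simp only [Finset.mem_filter, Finset.mem_univ, true_and]
          exact ⟨a, hi, by rw [hd.sym]; exact hab⟩
        rw [← hEx b hb] at h1
        simpa using h1
      have hpos : 0 < (Finset.univ.filter (fun i => x ∈ C i)).card := by
        have h2 : k ≤ (Finset.univ.filter (fun i => x ∈ C i)).card + n := by
          convert hC x
        omega
      obtain ⟨i, hi⟩ := Finset.card_pos.1 hpos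
      have hi : x ∈ C i := by simpa using hi
      have key : y ∈ C i ∧ HwConn d (C i ∩ f ⁻¹' V) r x y := by
        induction hxy with
        | refl => exact ⟨hi, Relation.ReflTransGen.refl⟩
        | tail _ hbc ih =>
          have hc := hstep i _ hbc.1.1 _ hbc.2.1.1 hbc.2.2 ih.1
          exact ⟨hc, Relation.ReflTransGen.tail ih.2
            ⟨⟨ih.1, hbc.1.2⟩, ⟨hc, hbc.2.1.2⟩, hbc.2.2⟩⟩
      have := hF i V (fun z hz z' hz' => (hV z hz z' hz').trans (by linarith)) x y
        (key.2.mono le_rfl (by linarith))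
      linarith
    · intro i
      rw [Fin.cons_succ]
      intro V hV x y hxy
      let V' : Set Z := {z | ∃ v ∈ V, e v z ≤ S}
      have hV' : ∀ z ∈ V', ∀ z' ∈ V', e z z' ≤ R + 2 * S := by
        rintro z ⟨v, hv, hvz⟩ z' ⟨v', hv', hvz'⟩
        have h1 := hV v hv v' hv'
        have h2 := he.tri z v z'
        have h3 := he.tri v v' z'
        rw [he.sym z v] at h2
        linarith
      have hcex : ∀ x, ∃ c, x ∈ C' i → c ∈ C i ∧ d x c < r := by
        intro x
        by_cases hx : x ∈ C' i
        · obtain ⟨c, h1, h2⟩ := hx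
          exact ⟨c, fun _ => ⟨h1, h2⟩⟩
        · exact ⟨x, fun h => absurd h hx⟩
      choose c hc using hcex
      have hmem : ∀ a ∈ C' i ∩ f ⁻¹' V, c a ∈ C i ∩ f ⁻¹' V' := by
        rintro a ⟨ha, haV⟩
        exact ⟨(hc a ha).1, f a, haV, hfS _ _ (hc a ha).2⟩
      have hlift : HwConn d (C i ∩ f ⁻¹' V') (3 * r) (c x) (c y) := by
        refine Relation.ReflTransGen.lift c ?_ _ _ hxy
        rintro a b ⟨ha, hb, hab⟩
        refine ⟨hmem a ha, hmem b hb, ?_⟩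
        have h1 := (hc a ha.1).2
        have h2 := (hc b hb.1).2
        have h3 := hd.tri (c a) a (c b)
        have h4 := hd.tri a b (c b)
        rw [hd.sym (c a) a] at h3
        linarith
      have h0 := hF i V' hV' _ _ hlift
      rcases hxy.eq_or_mem with rfl | hx
      · rw [hd.self]; linarith
      rcases (hxy.symm hd).eq_or_mem with rfl | hy
      · rw [hd.self]; linarith
      have h1 := (hc x hx.1).2
      have h2 := (hc y hy.1).2
      have h3 := hd.tri x (c x) y
      have h4 := hd.tri (c x) (c y) y
      rw [hd.sym (c y) y] at h4
      linarith
  · intro x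
    have h1 : k ≤ (Finset.univ.filter (fun i => x ∈ C i)).card + n := by
      convert hC x
    have h2 : (Finset.univ.filter (fun i => x ∈ C i)).card ≤
        (Finset.univ.filter (fun i => x ∈ C' i)).card := by
      apply Finset.card_le_card
      intro i hi
      simp only [Finset.mem_filter, Finset.mem_univ, true_and] at hi ⊢
      exact hsub i hi
    have h3' : ∀ F : Set X, (Finset.univ.filter
        (fun i => x ∈ (Fin.cons F C' : Fin (k + 1) → Set X) i)).card
        = (if x ∈ F then 1 else 0) + (Finset.univ.filter (fun i => x ∈ C' i)).card := by
      intro F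
      rw [Finset.card_filter, Fin.sum_univ_succ, Finset.card_filter]
      simp only [Fin.cons_zero, Fin.cons_succ]
    have h3 := h3' E
    have h4 : k + 1 ≤ (@ite ℕ (x ∈ E) (Classical.propDecidable _) 1 0)
        + (Finset.univ.filter (fun i => x ∈ C' i)).card + n := by
      split_ifs with hE
      · omega
      · have : ¬ ((Finset.univ.filter (fun i => x ∈ C' i)).card + n ≤ k) := hE
        omega
    have h6 := h4.trans_eq (congrArg (· + n) h3.symm)
    convert h6

theorem HwKol.add {d : X → X → ℝ} (hd : IsMetric d) {e : Z → Z → ℝ} (he : IsMetric e)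
    {f : X → Z} (hf : ∀ r : ℝ, 0 < r → ∃ S : ℝ, 0 < S ∧ ∀ x y, d x y < r → e (f x) (f y) ≤ S)
    {n : ℕ} (h : HwKol d e f n (n + 1)) (m : ℕ) : HwKol d e f n (n + 1 + m) := by
  induction m with
  | zero => exact h
  | succ m ih => exact HwKol.succ hd he hf (k := n + 1 + m) (by omega) ih

theorem HwASDimLE {dX : X → X → ℝ} {dY : Y → Y → ℝ} (hX : IsMetric dX) (hY : IsMetric dY)
    {h : X → Y} (hf : ∀ r : ℝ, 0 < r → ∃ S : ℝ, 0 < S ∧ ∀ x y, dX x y < r → dY (h x) (h y) ≤ S)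
    {n m : ℕ}
    (hfib : ∀ r : ℝ, 0 < r → ASDimUnifLE dX (fun y : Y => h ⁻¹' {z | dY y z < r}) n)
    (hm : ASDimLE dY univ m) : ASDimLE dX univ (m + n) := by
  classical
  have hdec : ∀ r : ℝ, 0 < r → ∃ D : ℝ, 0 < D ∧ ∃ B : Fin (m + 1) → Set Y,
      univ ⊆ (⋃ i, B i) ∧ ∀ i, HwBdd dY (B i) r D := by
    intro r hr
    obtain ⟨D, hD, U, _, h2, h3, h4⟩ := hm r hr
    exact ⟨D, hD, fun i => ⋃₀ U i, h2, fun i => HwBdd.of_family hY hD (h3 i) (h4 i)⟩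
  have hXQ : ∀ R : ℝ, 0 < R → HwQ dX dY h n R univ := by
    intro R hR
    obtain ⟨L, hL, B, hB, hBb⟩ := hdec (R + 1) (by linarith)
    have : ∀ s : Finset (Fin (m + 1)), HwQ dX dY h n R (⋃ i ∈ s, h ⁻¹' (B i)) := by
      intro s
      induction s using Finset.induction_on with
      | empty => simpa using HwQ.empty hX
      | insert a s _ ih =>
        rw [Finset.set_biUnion_insert]
        exact HwQ.union hX (HwQ.preimage hX hY hL hfib (hBb a)) ih
    have h1 := this Finset.univ
    have h2 : (⋃ i ∈ (Finset.univ : Finset (Fin (m + 1))), h ⁻¹' (B i)) = univ := by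
      apply eq_univ_of_forall
      intro x
      obtain ⟨i, hi⟩ := mem_iUnion.1 (hB (mem_univ (h x)))
      simp only [mem_iUnion]
      exact ⟨i, Finset.mem_univ i, hi⟩
    rwa [h2] at h1
  have hKX : HwKol dX dY h n (m + n + 1) := by
    have := HwKol.add hX hY hf (HwKol.of_Q hXQ) m
    rwa [show n + 1 + m = m + n + 1 by omega] at this
  have hU : IsMetric (fun _ _ : Unit => (0 : ℝ)) :=
    ⟨fun _ _ => le_rfl, fun _ _ => by simp, fun _ _ => rfl, fun _ _ _ => by simp⟩
  have hKY : HwKol dY (fun _ _ : Unit => (0 : ℝ)) (fun _ => ()) m (m + n + 1) := by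
    have h1 : HwKol dY (fun _ _ : Unit => (0 : ℝ)) (fun _ => ()) m (m + 1) := by
      apply HwKol.of_Q
      intro R hR r hr
      obtain ⟨D, hD, B, hB, hBb⟩ := hdec r hr
      exact ⟨D, hD, B, hB, fun j V _ => (hBb j).mono inter_subset_left le_rfl le_rfl⟩
    have := HwKol.add hY hU (fun r _ => ⟨1, one_pos, fun _ _ _ => zero_le_one⟩) h1 n
    rwa [show m + 1 + n = m + n + 1 by omega] at this
  intro r hr
  obtain ⟨S, hS, hfS⟩ := hf r hr
  obtain ⟨L, hL, B, hB, hBc⟩ := hKY (S + 1) 1 (by linarith) one_pos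
  have hBb : ∀ i, HwBdd dY (B i) (S + 1) L := by
    intro i
    have := hB i univ (fun _ _ _ _ => zero_le_one)
    simpa using this
  obtain ⟨D, hD, C, hC, hCc⟩ := hKX r L hr hL
  let A : Fin (m + n + 1) → Set X := fun i => C i ∩ h ⁻¹' (B i)
  have hA : ∀ i, HwBdd dX (A i) r D := by
    intro i x y hxy
    let V : Set Y := {z | HwConn dY (B i) (S + 1) (h x) z}
    have hV : ∀ z ∈ V, ∀ z' ∈ V, dY z z' ≤ L := fun z hz z' hz' =>
      hBb i _ _ (Relation.ReflTransGen.trans (HwConn.symm hY hz) hz')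
    have key : h y ∈ V ∧ HwConn dX (C i ∩ h ⁻¹' V) r x y := by
      induction hxy with
      | refl => exact ⟨Relation.ReflTransGen.refl, Relation.ReflTransGen.refl⟩
      | @tail b c _ hbc ih =>
        have h1 := hfS _ _ hbc.2.2
        have hc : h c ∈ V :=
          Relation.ReflTransGen.tail ih.1 ⟨hbc.1.2, hbc.2.1.2, by linarith⟩
        exact ⟨hc, Relation.ReflTransGen.tail ih.2 ⟨⟨hbc.1.1, ih.1⟩, ⟨hbc.2.1.1, hc⟩, hbc.2.2⟩⟩
    exact hC i V hV x y key.2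
  refine ⟨D, hD, fun i => {u | ∃ x ∈ A i, u = {y | y ∈ A i ∧ HwConn dX (A i) r x y}},
    fun _ _ _ => subset_univ _, ?_, ?_, ?_⟩
  · intro x _
    have h1 : m + n + 1 ≤ (Finset.univ.filter (fun i => x ∈ C i)).card + n := by
      convert hCc x
    have h2 : m + n + 1 ≤ (Finset.univ.filter (fun i => h x ∈ B i)).card + m := by
      convert hBc (h x)
    have h3 : ∃ i, x ∈ A i := by
      by_contra hne
      push Not at hne
      have hdis : Disjoint (Finset.univ.filter (fun i => x ∈ C i))
          (Finset.univ.filter (fun i => h x ∈ B i)) := by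
        rw [Finset.disjoint_left]
        intro i hi hi'
        simp only [Finset.mem_filter, Finset.mem_univ, true_and] at hi hi'
        exact hne i ⟨hi, hi'⟩
      have h4 := Finset.card_union_of_disjoint hdis
      have h5 := Finset.card_le_univ ((Finset.univ.filter (fun i => x ∈ C i)) ∪
          (Finset.univ.filter (fun i => h x ∈ B i)))
      rw [Fintype.card_fin] at h5
      omega
    obtain ⟨i, hi⟩ := h3
    exact mem_iUnion.2 ⟨i, _, ⟨x, hi, rfl⟩, hi, Relation.ReflTransGen.refl⟩
  · rintro i u ⟨x, hx, rfl⟩ a ⟨_, ha⟩ b ⟨_, hb⟩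
    exact hA i _ _ (Relation.ReflTransGen.trans (HwConn.symm hX ha) hb)
  · rintro i u ⟨x, hx, rfl⟩ v ⟨x', hx', rfl⟩ huv a ⟨haA, ha⟩ b ⟨hbA, hb⟩
    by_contra hlt
    push Not at hlt
    apply huv
    have hxx' : HwConn dX (A i) r x x' :=
      Relation.ReflTransGen.trans (Relation.ReflTransGen.tail ha ⟨haA, hbA, hlt⟩)
        (HwConn.symm hX hb)
    ext y
    exact ⟨fun hy => ⟨hy.1, Relation.ReflTransGen.trans (HwConn.symm hX hxx') hy.2⟩,
      fun hy => ⟨hy.1, Relation.ReflTransGen.trans hxx' hy.2⟩⟩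

end Helpers

/-- asymptotic Hurewicz mapping theorem for coarsely Lipschitz maps: if the
collections of preimages of `r`-balls have asymptotic dimension uniformly bounded by `n`
for all `r > 0`, then `asdim X ≤ asdim Y + n`. -/
theorem hurewicz_of_coarselyLipschitz
    {X Y : Type*} (dX : X → X → ℝ) (dY : Y → Y → ℝ)
    (hX : IsMetric dX) (hY : IsMetric dY)
    (h : X → Y) (hcl : IsCoarselyLipschitz dX dY h) (n : ℕ)
    (hfib : ∀ r : ℝ, 0 < r → ASDimUnifLE dX (fun y : Y => h ⁻¹' {z | dY y z < r}) n) :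
    asdim dX (univ : Set X) ≤ asdim dY (univ : Set Y) + (n : ℕ∞) := by
  have hf : ∀ r : ℝ, 0 < r → ∃ S : ℝ, 0 < S ∧ ∀ x y, dX x y < r → dY (h x) (h y) ≤ S := by
    obtain ⟨Φ, hΦ0, hΦm, _, hΦ⟩ := hcl
    intro r hr
    refine ⟨Φ r + 1, by linarith [hΦ0 r hr.le], fun x y hxy => ?_⟩
    have h1 := hΦ x y
    have h2 : Φ (dX x y) ≤ Φ r := hΦm (hX.1 x y) hr.le hxy.le
    linarith
  by_cases hne : {m | ASDimLE dY (univ : Set Y) m}.Nonempty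
  · obtain ⟨m, hm, hmeq⟩ := csInf_mem (hne.image (fun n : ℕ => (n : ℕ∞)))
    have h1 : asdim dY (univ : Set Y) = (m : ℕ∞) := hmeq.symm
    rw [h1]
    have h2 : asdim dX (univ : Set X) ≤ ((m + n : ℕ) : ℕ∞) :=
      sInf_le ⟨m + n, HwASDimLE hX hY hf hfib hm, rfl⟩
    simpa using h2
  · rw [not_nonempty_iff_eq_empty] at hne
    have h1 : asdim dY (univ : Set Y) = ⊤ := by
      unfold asdim
      rw [hne, image_empty, sInf_empty]
    rw [h1, top_add]
    exact le_top
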